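/- arXiv:1609.01221 — 4 statements merged into one kernel-verified Lean document; each statement's English description precedes it below -/
import Mathlib

section
/- Let G be a 2-connected simple graph with at least 5 vertices, let a, b, c, d be four distinct pairwise adjacent vertices of G, and set e = ab and f = cd. Then G contains an ef-theta. -/
open SimpleGraph

/-- Two u-v walks are internally disjoint if they share no vertices other than `u` and `v`. -/
def InternallyDisjoint {V : Type} {G : SimpleGraph V} {u v : V} (P Q : G.Walk u v) : Prop :=
  ∀ x : V, x ∈ P.support → x ∈ Q.support → x = u ∨ x = v

/-- A finite simple graph is 2-connected if it is connected, has at least 3 vertices,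
and deleting any single vertex leaves it connected. -/
def TwoConnected {V : Type} [Fintype V] (G : SimpleGraph V) : Prop :=
  G.Connected ∧ 3 ≤ Fintype.card V ∧
    ∀ v : V, (G.induce ({v}ᶜ : Set V)).Connected

/-- `G` contains an `ef`-theta: two distinct vertices joined by three pairwise internally
disjoint paths such that `e` and `f` lie on two different ones of these paths and the
third path has length at least 2. -/
def ContainsEfTheta {V : Type} (G : SimpleGraph V) (e f : Sym2 V) : Prop :=
  ∃ (u v : V), u ≠ v ∧ ∃ (P₁ P₂ P₃ : G.Walk u v),
    P₁.IsPath ∧ P₂.IsPath ∧ P₃.IsPath ∧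
    InternallyDisjoint P₁ P₂ ∧ InternallyDisjoint P₁ P₃ ∧ InternallyDisjoint P₂ P₃ ∧
    e ∈ P₁.edges ∧ f ∈ P₂.edges ∧ 2 ≤ P₃.length

/-- A walk ending in `K` can be cut at its first vertex in `K`. -/
theorem SimpleGraph.Walk.exists_walk_to_first_mem {V : Type} {G : SimpleGraph V} (K : Set V)
    {x y : V} (w : G.Walk x y) (hy : y ∈ K) :
    ∃ q ∈ K, ∃ w' : G.Walk x q, (∀ z ∈ w'.support, z ∈ K → z = q) ∧
      ∀ z ∈ w'.support, z ∈ w.support := by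
  induction w with
  | nil => exact ⟨_, hy, .nil, by simp, by simp⟩
  | @cons u v t h w ih =>
    by_cases hu : u ∈ K
    · exact ⟨u, hu, .nil, by simp, by simp⟩
    · obtain ⟨q, hq, w', h₁, h₂⟩ := ih hy
      refine ⟨q, hq, .cons h w', ?_, ?_⟩
      · simp only [Walk.support_cons, List.mem_cons]
        rintro z (rfl | hz) hzK
        · exact absurd hzK hu
        · exact h₁ z hz hzK
      · simp only [Walk.support_cons, List.mem_cons]
        rintro z (rfl | hz)
        · exact Or.inl rfl
        · exact Or.inr (h₂ z hz)

/-- In a 2-connected graph, a vertex set with two elements that misses a vertex has an ear of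
length at least two. -/
theorem TwoConnected.exists_ear {V : Type} [Fintype V] {G : SimpleGraph V} (hG : TwoConnected G)
    {K : Set V} (hK : K.Nontrivial) {x : V} (hx : x ∉ K) :
    ∃ p ∈ K, ∃ q ∈ K, p ≠ q ∧ ∃ Q : G.Walk p q, Q.IsPath ∧ 2 ≤ Q.length ∧
      ∀ z ∈ Q.support, z ∈ K → z = p ∨ z = q := by
  classical
  obtain ⟨k, hk⟩ := hK.nonempty
  obtain ⟨w⟩ := hG.1.preconnected x k
  obtain ⟨p, hp, w₁, h₁, -⟩ := w.exists_walk_to_first_mem K hk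
  obtain ⟨k', hk', hkp⟩ := hK.exists_ne p
  have hxp : x ≠ p := fun h => hx (h ▸ hp)
  obtain ⟨w', hw'⟩ : ∃ w' : G.Walk x k', p ∉ w'.support := by
    obtain ⟨w'⟩ := (hG.2.2 p).preconnected ⟨x, hxp⟩ ⟨k', hkp⟩
    refine ⟨w'.map (Embedding.induce ({p}ᶜ : Set V)).toHom, fun h => ?_⟩
    obtain ⟨z, -, hz⟩ := List.mem_map.mp ((Walk.support_map _ w') ▸ h)
    exact z.2 hz
  obtain ⟨q, hq, w₂, h₂, h₂'⟩ := w'.exists_walk_to_first_mem K hk'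
  have hp₂ : p ∉ w₂.support := fun h => hw' (h₂' p h)
  have hpq : p ≠ q := fun h => hp₂ (h ▸ w₂.end_mem_support)
  let W : G.Walk p q := w₁.reverse.append w₂
  refine ⟨p, hp, q, hq, hpq, W.bypass, W.bypass_isPath, ?_, ?_⟩
  · by_contra! hlt
    have hpos : W.bypass.length ≠ 0 := fun h => hpq (Walk.eq_of_length_eq_zero h)
    have hone : W.bypass.length = 1 := by omega
    have hedge : s(p, q) ∈ W.bypass.edges := by
      generalize W.bypass = B at hone
      cases B with
      | nil => simp at hone
      | cons h B =>
        cases B with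
        | nil => simp
        | cons h' B => simp at hone
    have := W.edges_bypass_subset_edges hedge
    simp only [W, Walk.edges_append, Walk.edges_reverse, List.mem_append, List.mem_reverse] at this
    rcases this with h | h
    · exact hpq (h₁ q (w₁.snd_mem_support_of_mem_edges h) hq).symm
    · exact hp₂ (w₂.fst_mem_support_of_mem_edges h)
  · intro z hz hzK
    have := W.support_bypass_subset_support hz
    simp only [W, Walk.mem_support_append_iff, Walk.support_reverse, List.mem_reverse] at this
    exact this.imp (h₁ z · hzK) (h₂ z · hzK)

theorem InternallyDisjoint.symm {V : Type} {G : SimpleGraph V} {u v : V} {P Q : G.Walk u v}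
    (h : InternallyDisjoint P Q) : InternallyDisjoint Q P :=
  fun x hQ hP => h x hP hQ

theorem ContainsEfTheta.symm {V : Type} {G : SimpleGraph V} {e f : Sym2 V}
    (h : ContainsEfTheta G e f) : ContainsEfTheta G f e := by
  obtain ⟨u, v, huv, P₁, P₂, P₃, h₁, h₂, h₃, h₁₂, h₁₃, h₂₃, he, hf, hl⟩ := h
  exact ⟨u, v, huv, P₂, P₁, P₃, h₂, h₁, h₃, h₁₂.symm, h₂₃, h₁₃, hf, he, hl⟩

/-- An ear of length at least two joining the ends of `ab` gives a theta. -/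
theorem containsEfTheta_of_ear_same_edge {V : Type} {G : SimpleGraph V} {a b c d : V}
    (hab : G.Adj a b) (hac : G.Adj a c) (had : a ≠ d) (hbc : b ≠ c) (hbd : G.Adj b d)
    (hcd : G.Adj c d) (Q : G.Walk a b) (hQ : Q.IsPath) (hl : 2 ≤ Q.length)
    (hc : c ∉ Q.support) (hd : d ∉ Q.support) : ContainsEfTheta G s(a, b) s(c, d) := by
  have := hab.ne
  have := hac.ne
  have := hbd.ne
  have := hcd.ne
  refine ⟨a, b, hab.ne, hab.toWalk, .cons hac (.cons hcd hbd.symm.toWalk), Q,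
    ?_, ?_, hQ, ?_, ?_, ?_, ?_, ?_, hl⟩ <;>
  simp [InternallyDisjoint, Walk.isPath_def] <;> grind

/-- An ear of length at least two joining an end of `ab` to an end of `cd` gives a theta. -/
theorem containsEfTheta_of_ear_between_edges {V : Type} {G : SimpleGraph V} {a b c d : V}
    (hab : G.Adj a b) (hac : a ≠ c) (had : G.Adj a d) (hbc : G.Adj b c) (hbd : b ≠ d)
    (hcd : G.Adj c d) (Q : G.Walk a c) (hQ : Q.IsPath) (hl : 2 ≤ Q.length)
    (hb : b ∉ Q.support) (hd : d ∉ Q.support) : ContainsEfTheta G s(a, b) s(c, d) := by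
  have := hab.ne
  have := had.ne
  have := hbc.ne
  have := hcd.ne
  refine ⟨a, c, hac, .cons hab hbc.toWalk, .cons had hcd.symm.toWalk, Q,
    ?_, ?_, hQ, ?_, ?_, ?_, ?_, ?_, hl⟩ <;>
  simp [InternallyDisjoint, Walk.isPath_def] <;> grind

theorem stmt_12 {V : Type} [Fintype V] (G : SimpleGraph V)
    (h2c : TwoConnected G) (hcard : 5 ≤ Fintype.card V)
    (a b c d : V)
    (hab : a ≠ b) (hac : a ≠ c) (had : a ≠ d) (hbc : b ≠ c) (hbd : b ≠ d) (hcd : c ≠ d)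
    (hab' : G.Adj a b) (hac' : G.Adj a c) (had' : G.Adj a d)
    (hbc' : G.Adj b c) (hbd' : G.Adj b d) (hcd' : G.Adj c d) :
    ContainsEfTheta G s(a, b) s(c, d) := by
  classical
  have hx : ∃ x, x ∉ ({a, b, c, d} : Finset V) := by
    by_contra! h
    have := Finset.card_le_four (a := a) (b := b) (c := c) (d := d)
    rw [Finset.eq_univ_of_forall h, Finset.card_univ] at this
    omega
  obtain ⟨x, hx⟩ := hx
  obtain ⟨p, hp, q, hq, hpq, Q, hQ, hl, hQK⟩ := h2c.exists_ear (K := {a, b, c, d})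
    ⟨a, by simp, b, by simp, hab⟩ (x := x) (by simpa using hx)
  have avoid : ∀ z ∈ ({a, b, c, d} : Set V), z ≠ p → z ≠ q → z ∉ Q.support :=
    fun z hz h₁ h₂ h => (hQK z h hz).elim h₁ h₂
  clear hQK
  have same {a b c d : V} := @containsEfTheta_of_ear_same_edge V G a b c d
  have between {a b c d : V} := @containsEfTheta_of_ear_between_edges V G a b c d
  simp only [Set.mem_insert_iff, Set.mem_singleton_iff] at hp hq avoid
  have := hab'.symm
  have := hac'.symm
  have := had'.symm
  have := hbc'.symm
  have := hbd'.symm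
  have := hcd'.symm
  have ha := avoid a (by simp)
  have hb := avoid b (by simp)
  have hc := avoid c (by simp)
  have hd := avoid d (by simp)
  rcases hp with rfl | rfl | rfl | rfl <;> rcases hq with rfl | rfl | rfl | rfl
  · exact absurd rfl hpq
  · apply same (Q := Q) <;> grind
  · apply between (Q := Q) <;> grind
  · rw [Sym2.eq_swap (a := c)]; apply between (Q := Q) <;> grind
  · rw [Sym2.eq_swap (a := q)]; apply same (Q := Q) <;> grind
  · exact absurd rfl hpq
  · rw [Sym2.eq_swap (a := a)]; apply between (Q := Q) <;> grind
  · rw [Sym2.eq_swap (a := a), Sym2.eq_swap (a := c)]; apply between (Q := Q) <;> grind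
  · apply ContainsEfTheta.symm; apply between (Q := Q) <;> grind
  · apply ContainsEfTheta.symm; rw [Sym2.eq_swap (a := a)]; apply between (Q := Q) <;> grind
  · exact absurd rfl hpq
  · apply ContainsEfTheta.symm; apply same (Q := Q) <;> grind
  · apply ContainsEfTheta.symm; rw [Sym2.eq_swap (a := c)]; apply between (Q := Q) <;> grind
  · apply ContainsEfTheta.symm; rw [Sym2.eq_swap (a := a), Sym2.eq_swap (a := c)]
    apply between (Q := Q) <;> grind
  · apply ContainsEfTheta.symm; rw [Sym2.eq_swap (a := q)]; apply same (Q := Q) <;> grind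
  · exact absurd rfl hpq
end

section
/- Let G be a 3-connected simple graph, let e be an edge of G, and let Z ⊆ V(G) with |Z| ≥ 3 such that at most one endpoint of e lies in Z. Then there exist a vertex p ∉ Z, three distinct vertices z₁, z₂, z₃ ∈ Z, and three paths in G from p to z₁, z₂, z₃ respectively, such that any two of the three paths share only the vertex p, each path meets Z only in its endpoint z_i, and the edge e lies on one of the three paths. -/
open SimpleGraph

/-- A finite simple graph is 3-connected if it is connected, has at least 4 vertices,
and deleting any two vertices leaves it connected. -/
def ThreeConnected {V : Type} [Fintype V] (G : SimpleGraph V) : Prop :=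
  G.Connected ∧ 4 ≤ Fintype.card V ∧
    ∀ u v : V, u ≠ v → (G.induce (({u, v} : Set V)ᶜ)).Connected

namespace SimpleGraph

variable {V : Type*} {G : SimpleGraph V}

/-- A walk ending in `S` can be shortened so that it meets `S` only in its endpoint. -/
theorem Walk.exists_walk_to_first_hit {u v : V} (p : G.Walk u v) (S : Set V) (hv : v ∈ S) :
    ∃ x ∈ S, ∃ q : G.Walk u x, (∀ y ∈ q.support, y ∈ p.support) ∧
      ∀ y ∈ q.support, y ∈ S → y = x := by
  induction p with
  | nil => exact ⟨_, hv, .nil, by simp, by simp⟩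
  | @cons u w v h p ih =>
    by_cases hu : u ∈ S
    · exact ⟨u, hu, .nil, by simp, by simp⟩
    · obtain ⟨x, hx, q, hq, hqS⟩ := ih hv
      refine ⟨x, hx, .cons h q, ?_, ?_⟩
      · intro y hy
        rw [Walk.support_cons, List.mem_cons] at hy ⊢
        exact hy.imp_right (hq y)
      · intro y hy hyS
        rw [Walk.support_cons, List.mem_cons] at hy
        rcases hy with rfl | hy
        · exact absurd hyS hu
        · exact hqS y hy hyS

theorem Walk.IsPath.append_of_disjoint {u v w : V} {p : G.Walk u v} {q : G.Walk v w}
    (hp : p.IsPath) (hq : q.IsPath) (h : ∀ x ∈ p.support, x ∈ q.support → x = v) :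
    (p.append q).IsPath := by
  rw [Walk.isPath_def] at *
  rw [Walk.support_append]
  rw [← Walk.cons_tail_support, List.nodup_cons] at hq
  refine List.Nodup.append hp hq.2 fun x hx hx' => ?_
  exact hq.1 (h x hx (List.mem_of_mem_tail hx') ▸ hx')

theorem Walk.IsPath.eq_of_mem_takeUntil_of_mem_dropUntil [DecidableEq V] {u v c x : V}
    {p : G.Walk u v} (hp : p.IsPath) (hc : c ∈ p.support)
    (h₁ : x ∈ (p.takeUntil c hc).support) (h₂ : x ∈ (p.dropUntil c hc).support) : x = c := by
  rw [← p.take_spec hc, Walk.isPath_def, Walk.support_append, List.nodup_append'] at hp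
  rw [← Walk.cons_tail_support, List.mem_cons] at h₂
  exact h₂.resolve_right fun h => hp.2.2 h₁ h

theorem exists_walk_avoiding_of_induce_connected {S : Set V} (h : (G.induce S).Connected)
    {u v : V} (hu : u ∈ S) (hv : v ∈ S) : ∃ p : G.Walk u v, ∀ x ∈ p.support, x ∈ S := by
  obtain ⟨p⟩ := h.preconnected ⟨u, hu⟩ ⟨v, hv⟩
  refine ⟨p.map (Embedding.induce S).toHom, fun x hx => ?_⟩
  erw [Walk.support_map, List.mem_map] at hx
  obtain ⟨y, -, rfl⟩ := hx
  exact y.2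

/-- Two vertices `a`, `b` are joined to `u`, `v` respectively by disjoint walks. -/
def DisjointlyLinked (G : SimpleGraph V) (a b u v : V) : Prop :=
  ∃ (A : G.Walk a u) (B : G.Walk b v), ∀ x ∈ A.support, x ∉ B.support

/-- There are walks from `a` and from `b` to `w` meeting only in `w`. -/
def JointlyLinked (G : SimpleGraph V) (a b w : V) : Prop :=
  ∃ (A : G.Walk a w) (B : G.Walk b w), ∀ x ∈ A.support, x ∈ B.support → x = w

theorem DisjointlyLinked.symm {a b u v : V} (h : G.DisjointlyLinked a b u v) :
    G.DisjointlyLinked b a v u := by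
  obtain ⟨A, B, h⟩ := h
  exact ⟨B, A, fun x hx hx' => h x hx' hx⟩

theorem JointlyLinked.symm {a b w : V} (h : G.JointlyLinked a b w) :
    G.JointlyLinked b a w := by
  obtain ⟨A, B, h⟩ := h
  exact ⟨B, A, fun x hx hx' => h x hx' hx⟩

theorem disjointlyLinked_of_hit {a b w t c : V} {A : G.Walk a w} {B : G.Walk b w}
    (hA : A.IsPath) (hAB : ∀ x ∈ A.support, x ∈ B.support → x = w) (hc : c ∈ A.support)
    (hcw : c ≠ w) (q : G.Walk t c) (hq : ∀ y ∈ q.support, y ∈ B.support → y = c) :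
    G.DisjointlyLinked a b t w := by
  classical
  refine ⟨(A.takeUntil c hc).append q.reverse, B, fun x hx hxB => ?_⟩
  rw [Walk.mem_support_append_iff, Walk.support_reverse, List.mem_reverse] at hx
  rcases hx with hx | hx
  · obtain rfl := hAB x (A.support_takeUntil_subset_support hc hx) hxB
    exact hcw (hA.eq_of_mem_takeUntil_of_mem_dropUntil hc hx (Walk.end_mem_support _)).symm
  · obtain rfl := hq x hx hxB
    exact hcw (hAB x hc hxB)

theorem JointlyLinked.disjointlyLinked
    (hG : ∀ w u v : V, u ≠ w → v ≠ w → ∃ p : G.Walk u v, w ∉ p.support)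
    {a b w t : V} (hab : a ≠ b) (h : G.JointlyLinked a b w) (ht : t ≠ w) :
    G.DisjointlyLinked a b t w ∨ G.DisjointlyLinked a b w t := by
  classical
  obtain ⟨A, B, hAB⟩ := h
  replace hAB : ∀ x ∈ A.bypass.support, x ∈ B.bypass.support → x = w := fun x hx hx' =>
    hAB x (A.support_bypass_subset_support hx) (B.support_bypass_subset_support hx')
  let S : Set V := {x | x ∈ A.bypass.support ∨ x ∈ B.bypass.support}
  obtain ⟨u, huS, huw⟩ : ∃ u ∈ S, u ≠ w := by
    by_cases haw : a = w
    · exact ⟨b, Or.inr (Walk.start_mem_support _), fun hbw => hab (haw.trans hbw.symm)⟩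
    · exact ⟨a, Or.inl (Walk.start_mem_support _), haw⟩
  obtain ⟨p, hp⟩ := hG w t u ht huw
  obtain ⟨c, hcS, q, hqp, hqS⟩ := p.exists_walk_to_first_hit S huS
  have hcw : c ≠ w := fun h => hp (h ▸ hqp c (Walk.end_mem_support _))
  rcases hcS with hc | hc
  · exact Or.inl (disjointlyLinked_of_hit A.bypass_isPath hAB hc hcw q
      fun y hy hyB => hqS y hy (Or.inr hyB))
  · exact Or.inr (disjointlyLinked_of_hit B.bypass_isPath (fun x hx hx' => hAB x hx' hx) hc hcw q
      fun y hy hyA => hqS y hy (Or.inl hyA)).symm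

theorem DisjointlyLinked.jointlyLinked {a b w t : V} (h : G.DisjointlyLinked a b t w)
    (hwt : G.Adj w t) : G.JointlyLinked a b t := by
  obtain ⟨A, B, hAB⟩ := h
  refine ⟨A, B.concat hwt, fun x hx hx' => ?_⟩
  rw [Walk.support_concat, List.mem_append, List.mem_singleton] at hx'
  exact hx'.resolve_left (hAB x hx)

theorem jointlyLinked_of_connected (hconn : G.Connected)
    (hG : ∀ w u v : V, u ≠ w → v ≠ w → ∃ p : G.Walk u v, w ∉ p.support)
    {a b : V} (hab : a ≠ b) (w : V) : G.JointlyLinked a b w := by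
  obtain ⟨p⟩ := hconn.preconnected w a
  induction p with
  | nil =>
    obtain ⟨B⟩ := hconn.preconnected b _
    exact ⟨.nil, B, by simp⟩
  | cons h p ih =>
    rcases (ih hab).disjointlyLinked hG hab h.ne with h' | h'
    · exact h'.jointlyLinked h.symm
    · exact (h'.symm.jointlyLinked h.symm).symm

/-- In a connected graph without cut vertices, any two vertices are joined to any set with two
elements by disjoint paths that stop at the first vertex of the set. -/
theorem exists_disjoint_paths_to_set (hconn : G.Connected)
    (hG : ∀ w u v : V, u ≠ w → v ≠ w → ∃ p : G.Walk u v, w ∉ p.support)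
    {a b : V} (hab : a ≠ b) {Z : Set V} (hZ : Z.Nontrivial) :
    ∃ x ∈ Z, ∃ y ∈ Z, ∃ (A : G.Walk a x) (B : G.Walk b y), A.IsPath ∧ B.IsPath ∧
      (∀ v ∈ A.support, v ∉ B.support) ∧ (∀ v ∈ A.support, v ∈ Z → v = x) ∧
      (∀ v ∈ B.support, v ∈ Z → v = y) := by
  classical
  obtain ⟨u, hu, v, hv, h⟩ : ∃ u ∈ Z, ∃ v ∈ Z, G.DisjointlyLinked a b u v := by
    obtain ⟨u, hu, v, hv, huv⟩ := hZ
    rcases (jointlyLinked_of_connected hconn hG hab v).disjointlyLinked hG hab huv with h | h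
    · exact ⟨u, hu, v, hv, h⟩
    · exact ⟨v, hv, u, hu, h⟩
  obtain ⟨A, B, hAB⟩ := h
  obtain ⟨x, hx, A', hA', hA'Z⟩ := A.exists_walk_to_first_hit Z hu
  obtain ⟨y, hy, B', hB', hB'Z⟩ := B.exists_walk_to_first_hit Z hv
  exact ⟨x, hx, y, hy, A'.bypass, B'.bypass, A'.bypass_isPath, B'.bypass_isPath,
    fun v h₁ h₂ => hAB v (hA' v (A'.support_bypass_subset_support h₁)) (hB' v (B'.support_bypass_subset_support h₂)),
    fun v h => hA'Z v (A'.support_bypass_subset_support h),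
    fun v h => hB'Z v (B'.support_bypass_subset_support h)⟩

/-- A path with both ends in `Z` through the edge `ab`, together with a path from an inner vertex
`p` to a third vertex of `Z`, is a fan from `p` to `Z`. -/
theorem exists_fan_of_branch {a b x y z p : V} {Z : Set V} (hab : G.Adj a b)
    (hx : x ∈ Z) (hy : y ∈ Z) (hz : z ∈ Z) {A : G.Walk a x} {B : G.Walk b y}
    (hA : A.IsPath) (hB : B.IsPath) (hAB : ∀ v ∈ A.support, v ∉ B.support)
    (hAZ : ∀ v ∈ A.support, v ∈ Z → v = x) (hBZ : ∀ v ∈ B.support, v ∈ Z → v = y)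
    (hpA : p ∈ A.support) (hpx : p ≠ x) {Q : G.Walk p z} (hQ : Q.IsPath)
    (hQA : ∀ v ∈ Q.support, v ∈ A.support → v = p) (hQB : ∀ v ∈ Q.support, v ∉ B.support)
    (hQZ : ∀ v ∈ Q.support, v ∈ Z → v = z) :
    ∃ (p z₁ z₂ z₃ : V), p ∉ Z ∧ z₁ ∈ Z ∧ z₂ ∈ Z ∧ z₃ ∈ Z ∧
      z₁ ≠ z₂ ∧ z₁ ≠ z₃ ∧ z₂ ≠ z₃ ∧
      ∃ (P₁ : G.Walk p z₁) (P₂ : G.Walk p z₂) (P₃ : G.Walk p z₃),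
        P₁.IsPath ∧ P₂.IsPath ∧ P₃.IsPath ∧
        (∀ x : V, x ∈ P₁.support → x ∈ P₂.support → x = p) ∧
        (∀ x : V, x ∈ P₁.support → x ∈ P₃.support → x = p) ∧
        (∀ x : V, x ∈ P₂.support → x ∈ P₃.support → x = p) ∧
        (∀ x : V, x ∈ P₁.support → x ∈ Z → x = z₁) ∧
        (∀ x : V, x ∈ P₂.support → x ∈ Z → x = z₂) ∧
        (∀ x : V, x ∈ P₃.support → x ∈ Z → x = z₃) ∧
        (s(a, b) ∈ P₁.edges ∨ s(a, b) ∈ P₂.edges ∨ s(a, b) ∈ P₃.edges) := by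
  classical
  have hpZ : p ∉ Z := fun h => hpx (hAZ p hpA h)
  have htake : ∀ v ∈ (A.takeUntil p hpA).support, v ∈ A.support :=
    fun v hv => A.support_takeUntil_subset_support hpA hv
  have hdrop : ∀ v ∈ (A.dropUntil p hpA).support, v ∈ A.support :=
    fun v hv => A.support_dropUntil_subset_support hpA hv
  have hsupp : ∀ v, v ∈ ((A.takeUntil p hpA).reverse.append (.cons hab B)).support →
      v ∈ (A.takeUntil p hpA).support ∨ v ∈ B.support := by
    intro v hv
    rw [Walk.mem_support_append_iff, Walk.support_reverse, List.mem_reverse, Walk.support_cons,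
      List.mem_cons] at hv
    rcases hv with hv | rfl | hv
    · exact Or.inl hv
    · exact Or.inl (Walk.start_mem_support _)
    · exact Or.inr hv
  refine ⟨p, x, y, z, hpZ, hx, hy, hz, ?_, ?_, ?_, A.dropUntil p hpA,
    (A.takeUntil p hpA).reverse.append (.cons hab B), Q, hA.dropUntil hpA, ?_, hQ,
    ?_, ?_, ?_, ?_, ?_, hQZ, ?_⟩
  · rintro rfl
    exact hAB x (Walk.end_mem_support _) (Walk.end_mem_support _)
  · rintro rfl
    exact hpx (hQA x (Walk.end_mem_support _) (Walk.end_mem_support _)).symm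
  · rintro rfl
    exact hQB y (Walk.end_mem_support _) (Walk.end_mem_support _)
  · refine (hA.takeUntil hpA).reverse.append_of_disjoint
      (hB.cons (hAB a (Walk.start_mem_support _))) fun v hv hv' => ?_
    rw [Walk.support_reverse, List.mem_reverse] at hv
    rw [Walk.support_cons, List.mem_cons] at hv'
    exact hv'.resolve_right (hAB v (htake v hv))
  · intro v hv hv'
    rcases hsupp v hv' with h | h
    · exact hA.eq_of_mem_takeUntil_of_mem_dropUntil hpA h hv
    · exact absurd h (hAB v (hdrop v hv))
  · exact fun v hv hv' => hQA v hv' (hdrop v hv)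
  · intro v hv hv'
    rcases hsupp v hv with h | h
    · exact hQA v hv' (htake v h)
    · exact absurd h (hQB v hv')
  · exact fun v hv => hAZ v (hdrop v hv)
  · intro v hv hvZ
    rcases hsupp v hv with h | h
    · obtain rfl := hAZ v (htake v h) hvZ
      exact absurd (hA.eq_of_mem_takeUntil_of_mem_dropUntil hpA h (Walk.end_mem_support _)).symm hpx
    · exact hBZ v h hvZ
  · right; left
    simp [Walk.edges_append]

end SimpleGraph

theorem ThreeConnected.exists_walk_avoiding {V : Type} [Fintype V] {G : SimpleGraph V}
    (h : ThreeConnected G) (w u v : V) (hu : u ≠ w) (hv : v ≠ w) :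
    ∃ p : G.Walk u v, w ∉ p.support := by
  classical
  obtain ⟨t, ht⟩ : ∃ t, t ∉ ({w, u, v} : Finset V) := by
    by_contra! hall
    have h₁ := Finset.card_le_card (fun t _ => hall t : Finset.univ ⊆ ({w, u, v} : Finset V))
    have h₂ := h.2.1
    have h₃ := Finset.card_le_three (a := w) (b := u) (c := v)
    rw [Finset.card_univ] at h₁
    omega
  simp only [Finset.mem_insert, Finset.mem_singleton, not_or] at ht
  obtain ⟨p, hp⟩ := exists_walk_avoiding_of_induce_connected (h.2.2 w t (Ne.symm ht.1))
    (u := u) (v := v) (by simp [hu, Ne.symm ht.2.1]) (by simp [hv, Ne.symm ht.2.2])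
  exact ⟨p, fun hw => hp w hw (by simp)⟩

theorem stmt_13 {V : Type} [Fintype V] (G : SimpleGraph V)
    (h3c : ThreeConnected G)
    (a₀ b₀ : V) (he : G.Adj a₀ b₀)
    (Z : Set V) (hZ : 3 ≤ Z.ncard)
    (hend : ¬ (a₀ ∈ Z ∧ b₀ ∈ Z)) :
    ∃ (p z₁ z₂ z₃ : V), p ∉ Z ∧ z₁ ∈ Z ∧ z₂ ∈ Z ∧ z₃ ∈ Z ∧
      z₁ ≠ z₂ ∧ z₁ ≠ z₃ ∧ z₂ ≠ z₃ ∧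
      ∃ (P₁ : G.Walk p z₁) (P₂ : G.Walk p z₂) (P₃ : G.Walk p z₃),
        P₁.IsPath ∧ P₂.IsPath ∧ P₃.IsPath ∧
        (∀ x : V, x ∈ P₁.support → x ∈ P₂.support → x = p) ∧
        (∀ x : V, x ∈ P₁.support → x ∈ P₃.support → x = p) ∧
        (∀ x : V, x ∈ P₂.support → x ∈ P₃.support → x = p) ∧
        (∀ x : V, x ∈ P₁.support → x ∈ Z → x = z₁) ∧
        (∀ x : V, x ∈ P₂.support → x ∈ Z → x = z₂) ∧
        (∀ x : V, x ∈ P₃.support → x ∈ Z → x = z₃) ∧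
        (s(a₀, b₀) ∈ P₁.edges ∨ s(a₀, b₀) ∈ P₂.edges ∨ s(a₀, b₀) ∈ P₃.edges) := by
  classical
  have hZnt : Z.Nontrivial := (Set.one_lt_ncard_iff_nontrivial).1 (by omega)
  obtain ⟨x, hx, y, hy, A, B, hA, hB, hAB, hAZ, hBZ⟩ :=
    exists_disjoint_paths_to_set h3c.1 h3c.exists_walk_avoiding he.ne hZnt
  have hxy : x ≠ y := by
    rintro rfl
    exact hAB x (Walk.end_mem_support _) (Walk.end_mem_support _)
  obtain ⟨z, hz, hzxy⟩ : ∃ z ∈ Z, z ∉ ({x, y} : Set V) :=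
    Set.exists_mem_notMem_of_ncard_lt_ncard (by rw [Set.ncard_pair hxy]; omega)
  let I : Set V := {v | (v ∈ A.support ∨ v ∈ B.support) ∧ v ∉ Z}
  obtain ⟨u, hu⟩ : I.Nonempty := by
    by_cases ha : a₀ ∈ Z
    · exact ⟨b₀, Or.inr (Walk.start_mem_support _), fun hb => hend ⟨ha, hb⟩⟩
    · exact ⟨a₀, Or.inl (Walk.start_mem_support _), ha⟩
  have huxy : u ∉ ({x, y} : Set V) := by
    rintro (rfl | rfl)
    exacts [hu.2 hx, hu.2 hy]
  obtain ⟨W, hW⟩ := exists_walk_avoiding_of_induce_connected (h3c.2.2 x y hxy) hzxy huxy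
  obtain ⟨p, hpI, W₁, hW₁, hW₁I⟩ := W.exists_walk_to_first_hit I hu
  obtain ⟨z', hz', W₂, hW₂, hW₂Z⟩ := W₁.reverse.exists_walk_to_first_hit Z hz
  have hsub : ∀ v ∈ W₂.bypass.support, v ∈ W₁.support := fun v hv => by
    simpa using hW₂ v (W₂.support_bypass_subset_support hv)
  have hQ : ∀ v ∈ W₂.bypass.support, v ∈ A.support ∨ v ∈ B.support → v = p := by
    intro v hv hv'
    refine hW₁I v (hsub v hv) ⟨hv', fun hvZ => hW v (hW₁ v (hsub v hv)) ?_⟩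
    exact hv'.imp (fun h => hAZ v h hvZ) (fun h => hBZ v h hvZ)
  have hQZ : ∀ v ∈ W₂.bypass.support, v ∈ Z → v = z' :=
    fun v hv => hW₂Z v (W₂.support_bypass_subset_support hv)
  rcases hpI.1 with hp | hp
  · exact exists_fan_of_branch he hx hy hz' hA hB hAB hAZ hBZ hp (fun h => hpI.2 (h ▸ hx))
      W₂.bypass_isPath (fun v hv h => hQ v hv (Or.inl h))
      (fun v hv h => hAB p hp (hQ v hv (Or.inr h) ▸ h)) hQZ
  · rw [Sym2.eq_swap]
    exact exists_fan_of_branch he.symm hy hx hz' hB hA (fun v h h' => hAB v h' h) hBZ hAZ hp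
      (fun h => hpI.2 (h ▸ hy)) W₂.bypass_isPath (fun v hv h => hQ v hv (Or.inr h))
      (fun v hv h => hAB p (hQ v hv (Or.inl h) ▸ h) hp) hQZ
end

section
/- Let t ≥ 1 be an integer and let (G,w) be a weighted graph with G 2-connected, containing a cycle C with w(C) ≥ t. Then for every two distinct vertices u, v of G there is a u–v path P in G with 2·w(P) ≥ t. -/
open SimpleGraph

/-- The weight of a walk: the sum of the weights of its edges. -/
def walkWeight {V : Type} {G : SimpleGraph V} (w : Sym2 V → ℕ) {u v : V} (P : G.Walk u v) : ℕ :=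
  (P.edges.map w).sum

theorem walkWeight_append {V : Type} {G : SimpleGraph V} (w : Sym2 V → ℕ) {a b c : V}
    (P : G.Walk a b) (Q : G.Walk b c) :
    walkWeight w (P.append Q) = walkWeight w P + walkWeight w Q := by
  simp [walkWeight]

theorem walkWeight_reverse {V : Type} {G : SimpleGraph V} (w : Sym2 V → ℕ) {a b : V}
    (P : G.Walk a b) : walkWeight w P.reverse = walkWeight w P := by
  simp [walkWeight, List.sum_reverse]

theorem walkWeight_rotate {V : Type} [DecidableEq V] {G : SimpleGraph V} (w : Sym2 V → ℕ)
    {a b : V} (C : G.Walk a a) (h : b ∈ C.support) :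
    walkWeight w (C.rotate b h) = walkWeight w C :=
  ((C.rotate_edges b h).perm.map w).sum_eq

/-- There is an `a`–`b` path inside `S` whose weight is at least half of `t`. -/
def HasHeavyPath {V : Type} (G : SimpleGraph V) (w : Sym2 V → ℕ) (t : ℕ) (S : Set V)
    (a b : V) : Prop :=
  ∃ P : G.Walk a b, P.IsPath ∧ t ≤ 2 * walkWeight w P ∧ ∀ z ∈ P.support, z ∈ S

/-- Any two distinct vertices of `S` are joined by a heavy path inside `S`. -/
def HeavilyLinked {V : Type} (G : SimpleGraph V) (w : Sym2 V → ℕ) (t : ℕ) (S : Set V) : Prop :=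
  ∀ a ∈ S, ∀ b ∈ S, a ≠ b → HasHeavyPath G w t S a b

section

variable {V : Type} {G : SimpleGraph V} {w : Sym2 V → ℕ} {t : ℕ} {S T : Set V} {a b c : V}

theorem HasHeavyPath.symm (h : HasHeavyPath G w t S a b) : HasHeavyPath G w t S b a := by
  obtain ⟨P, hP, ht, hS⟩ := h
  exact ⟨P.reverse, hP.reverse, by rwa [walkWeight_reverse], by simpa using hS⟩

theorem HasHeavyPath.mono (h : HasHeavyPath G w t S a b) (hST : S ⊆ T) :
    HasHeavyPath G w t T a b := by
  obtain ⟨P, hP, ht, hS⟩ := h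
  exact ⟨P, hP, ht, fun z hz => hST (hS z hz)⟩

theorem isPath_append_of_inter {P : G.Walk a b} {Q : G.Walk b c} (hP : P.IsPath) (hQ : Q.IsPath)
    (h : ∀ z ∈ P.support, z ∈ Q.support → z = b) : (P.append Q).IsPath := by
  rw [Walk.isPath_def, Walk.support_append, List.nodup_append]
  refine ⟨hP.support_nodup, hQ.support_nodup.tail, fun z hz y hy hzy => ?_⟩
  subst hzy
  have := h z hz (List.mem_of_mem_tail hy)
  subst this
  have hn := hQ.support_nodup
  rw [← Walk.cons_tail_support] at hn
  exact (List.nodup_cons.1 hn).1 hy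

theorem inter_of_isPath_append {P : G.Walk a b} {Q : G.Walk b c} (h : (P.append Q).IsPath) :
    ∀ z ∈ P.support, z ∈ Q.support → z = b := by
  intro z hP hQ
  rw [Walk.isPath_def, Walk.support_append, List.nodup_append] at h
  rw [← Walk.cons_tail_support, List.mem_cons] at hQ
  exact hQ.elim id fun hQ => absurd rfl (h.2.2 z hP z hQ)

/-- Prolonging a heavy path at its start by a path that meets `S` only in its end. -/
theorem HasHeavyPath.prepend (h : HasHeavyPath G w t S b c) {P : G.Walk a b} (hP : P.IsPath)
    (hPS : ∀ z ∈ P.support, z ∈ S → z = b) :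
    HasHeavyPath G w t (S ∪ {z | z ∈ P.support}) a c := by
  obtain ⟨Q, hQ, ht, hS⟩ := h
  refine ⟨P.append Q, isPath_append_of_inter hP hQ fun z hz hz' => hPS z hz (hS z hz'), ?_, ?_⟩
  · rw [walkWeight_append]; omega
  · intro z hz
    rw [Walk.mem_support_append_iff] at hz
    exact hz.elim Or.inr fun h => Or.inl (hS z h)

theorem HeavilyLinked.hasHeavyPath_ear_of_ne (hS : HeavilyLinked G w t S) {s s' x y : V}
    (hs : s ∈ S) {E : G.Walk s s'} (hE : E.IsPath)
    (hES : ∀ z ∈ E.support, z ∈ S → z = s ∨ z = s') (hs' : s' ∈ S)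
    (hx : x ∈ E.support) (hxS : x ∉ S) (hy : y ∈ S) (hys : y ≠ s) :
    HasHeavyPath G w t (S ∪ {z | z ∈ E.support}) x y := by
  obtain ⟨A, B, rfl⟩ := Walk.mem_support_iff_exists_append.1 hx
  have hAB := inter_of_isPath_append hE
  refine ((hS s hs y hy hys.symm).prepend (P := A.reverse) hE.of_append_left.reverse ?_).mono ?_
  · intro z hz hzS
    rw [Walk.support_reverse, List.mem_reverse] at hz
    refine (hES z (by simp [hz]) hzS).resolve_right fun h => ?_
    subst h
    exact hxS (hAB z hz B.end_mem_support ▸ hzS)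
  · rintro z (hz | hz)
    · exact Or.inl hz
    · exact Or.inr (by simpa using Or.inl (by simpa using hz))

theorem HeavilyLinked.hasHeavyPath_ear (hS : HeavilyLinked G w t S) {s s' x y : V}
    (hs : s ∈ S) {E : G.Walk s s'} (hE : E.IsPath)
    (hES : ∀ z ∈ E.support, z ∈ S → z = s ∨ z = s') (hs' : s' ∈ S) (hne : s ≠ s')
    (hx : x ∈ E.support) (hxS : x ∉ S) (hy : y ∈ S) :
    HasHeavyPath G w t (S ∪ {z | z ∈ E.support}) x y := by
  by_cases hys : y = s
  · subst hys
    have := hS.hasHeavyPath_ear_of_ne hs' (E := E.reverse) hE.reverse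
      (fun z hz hzS => (hES z (by simpa using hz) hzS).symm) hs (by simpa using hx) hxS hy hne
    simpa using this
  · exact hS.hasHeavyPath_ear_of_ne hs hE hES hs' hx hxS hy hys

theorem HeavilyLinked.hasHeavyPath_of_append (hS : HeavilyLinked G w t S) {s s' x y : V}
    (hs : s ∈ S) (hs' : s' ∈ S) (hne : s ≠ s') {A : G.Walk s x} {B : G.Walk x y}
    {C : G.Walk y s'} (hE : (A.append (B.append C)).IsPath)
    (hES : ∀ z ∈ (A.append (B.append C)).support, z ∈ S → z = s ∨ z = s')
    (hxy : x ≠ y) :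
    HasHeavyPath G w t (S ∪ {z | z ∈ (A.append (B.append C)).support}) x y := by
  have hA := inter_of_isPath_append hE
  have hC := inter_of_isPath_append hE.of_append_right
  have hAC : ∀ z ∈ A.support, z ∉ C.support := fun z hz hz' => by
    have := hA z hz (by simp [hz'])
    subst this
    exact hxy (hC z B.start_mem_support hz')
  have hAS : ∀ z ∈ A.support, z ∈ S → z = s := fun z hz hzS =>
    (hES z (by simp [hz]) hzS).resolve_right fun h => hAC z hz (h ▸ C.end_mem_support)
  have hCS : ∀ z ∈ C.support, z ∈ S → z = s' := fun z hz hzS =>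
    (hES z (by simp [hz]) hzS).resolve_left fun h => hAC z (h ▸ A.start_mem_support) hz
  have h₁ := (hS s hs s' hs' hne).prepend (P := A.reverse) hE.of_append_left.reverse
    (by simpa using hAS)
  have h₂ := h₁.symm.prepend (P := C) hE.of_append_right.of_append_right (by
    rintro z hz (hzS | hzA)
    · exact hCS z hz hzS
    · exact absurd hz (hAC z (by simpa using hzA)))
  refine h₂.symm.mono ?_
  rintro z ((hz | hz) | hz)
  · exact Or.inl hz
  · exact Or.inr (by simpa using Or.inl (by simpa using hz))
  · exact Or.inr (by simpa using Or.inr (Or.inr hz))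

theorem HeavilyLinked.union_ear (hS : HeavilyLinked G w t S) {s s' : V}
    (hs : s ∈ S) (hs' : s' ∈ S) (hne : s ≠ s') {E : G.Walk s s'} (hE : E.IsPath)
    (hES : ∀ z ∈ E.support, z ∈ S → z = s ∨ z = s') :
    HeavilyLinked G w t (S ∪ {z | z ∈ E.support}) := by
  intro x hx y hy hxy
  by_cases hxS : x ∈ S
  · by_cases hyS : y ∈ S
    · exact (hS x hxS y hyS hxy).mono Set.subset_union_left
    · exact (hS.hasHeavyPath_ear hs hE hES hs' hne (hy.resolve_left hyS) hyS hxS).symm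
  · have hxE := hx.resolve_left hxS
    by_cases hyS : y ∈ S
    · exact hS.hasHeavyPath_ear hs hE hES hs' hne hxE hxS hyS
    · have hyE := hy.resolve_left hyS
      obtain ⟨A, B, rfl⟩ := Walk.mem_support_iff_exists_append.1 hxE
      rcases (Walk.mem_support_append_iff _ _).1 hyE with hyA | hyB
      · obtain ⟨A₁, A₂, rfl⟩ := Walk.mem_support_iff_exists_append.1 hyA
        rw [← Walk.append_assoc] at hE hES ⊢
        exact (hS.hasHeavyPath_of_append hs hs' hne hE hES hxy.symm).symm
      · obtain ⟨B₁, B₂, rfl⟩ := Walk.mem_support_iff_exists_append.1 hyB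
        exact hS.hasHeavyPath_of_append hs hs' hne hE hES hxy

theorem SimpleGraph.Walk.exists_isPath_first_mem (p : G.Walk a b) (ha : a ∉ S) (hb : b ∈ S) :
    ∃ c ∈ S, ∃ q : G.Walk a c, q.IsPath ∧ (∀ z ∈ q.support, z ∈ p.support) ∧
      ∀ z ∈ q.support, z ∈ S → z = c := by
  classical
  suffices h : ∃ c ∈ S, ∃ q : G.Walk a c, (∀ z ∈ q.support, z ∈ p.support) ∧
      ∀ z ∈ q.support, z ∈ S → z = c by
    obtain ⟨c, hc, q, hqp, hqS⟩ := h
    exact ⟨c, hc, q.bypass, q.bypass_isPath,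
      fun z hz => hqp z (q.support_bypass_subset_support hz),
      fun z hz => hqS z (q.support_bypass_subset_support hz)⟩
  induction p with
  | nil => exact absurd hb ha
  | @cons u v _ h p ih =>
    by_cases hv : v ∈ S
    · refine ⟨v, hv, .cons h .nil, ?_, ?_⟩
      · simp
      · simp [ha]
    · obtain ⟨c, hc, q, hqp, hqS⟩ := ih hv hb
      refine ⟨c, hc, .cons h q, ?_, ?_⟩
      · simp only [Walk.support_cons, List.mem_cons]
        exact fun z hz => hz.imp_right (hqp z)
      · simp only [Walk.support_cons, List.mem_cons]
        rintro z (rfl | hz) hzS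
        · exact absurd hzS ha
        · exact hqS z hz hzS

theorem exists_ear (hG : G.Connected) (hdel : ∀ v : V, (G.induce ({v}ᶜ : Set V)).Connected)
    (hS : S.Nontrivial) {x : V} (hx : x ∉ S) :
    ∃ s ∈ S, ∃ s' ∈ S, s ≠ s' ∧ ∃ E : G.Walk s s', E.IsPath ∧
      (∀ z ∈ E.support, z ∈ S → z = s ∨ z = s') ∧ ∃ y ∈ E.support, y ∉ S := by
  obtain ⟨c, hc⟩ := hS.nonempty
  obtain ⟨p⟩ := hG.preconnected c x
  obtain ⟨d, -, hs, hy⟩ := p.exists_boundary_dart S hc hx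
  obtain ⟨⟨s, y⟩, hsy⟩ := d
  dsimp only at hs hy hsy
  obtain ⟨c, hc, hcs⟩ := hS.exists_ne s
  have hys : y ≠ s := fun h => hy (h ▸ hs)
  obtain ⟨q⟩ := (hdel s).preconnected ⟨y, hys⟩ ⟨c, hcs⟩
  let q' : G.Walk y c := q.map (Embedding.induce _).toHom
  obtain ⟨s', hs', r, hr, hrq, hrS⟩ := q'.exists_isPath_first_mem hy hc
  have hsr : s ∉ r.support := fun h => by
    have : s ∈ (q.map (Embedding.induce _).toHom).support := hrq s h
    rw [Walk.support_map, List.mem_map] at this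
    obtain ⟨⟨z, hz⟩, -, hzs⟩ := this
    exact hz hzs
  refine ⟨s, hs, s', hs', fun h => hsr (h ▸ r.end_mem_support), .cons hsy r,
    hr.cons hsr, ?_, y, ?_, hy⟩
  · simp only [Walk.support_cons, List.mem_cons]
    exact fun z hz hzS => hz.imp_right fun h => hrS z h hzS
  · rw [Walk.support_cons]
    exact List.mem_cons_of_mem _ r.start_mem_support

theorem SimpleGraph.Walk.IsCycle.heavilyLinked {C : G.Walk a a} (hC : C.IsCycle)
    (ht : t ≤ walkWeight w C) : HeavilyLinked G w t {z | z ∈ C.support} := by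
  classical
  intro u hu v hv huv
  have hC' := hC.rotate hu
  have hsupp : ∀ z, z ∈ (C.rotate u hu).support ↔ z ∈ C.support := fun z =>
    C.mem_support_rotate_iff u hu
  rw [← walkWeight_rotate w C hu] at ht
  have hv' := (hsupp v).2 hv
  simp only [← hsupp]
  generalize C.rotate u hu = D at hC' ht hv'
  obtain ⟨P, Q, rfl⟩ := Walk.mem_support_iff_exists_append.1 hv'
  rw [walkWeight_append] at ht
  have hP : P.IsPath := hC'.isPath_of_append_left (Walk.not_nil_of_ne huv.symm)
  have hQ : Q.IsPath := hC'.isPath_of_append_right (Walk.not_nil_of_ne huv)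
  by_cases h : t ≤ 2 * walkWeight w P
  · exact ⟨P, hP, h, fun z hz => by simp [hz]⟩
  · exact ⟨Q.reverse, hQ.reverse, by rw [walkWeight_reverse]; omega,
      fun z hz => by simp_all⟩

end

theorem stmt_14 {V : Type} [Fintype V] (G : SimpleGraph V) (w : Sym2 V → ℕ)
    (hw : ∀ e ∈ G.edgeSet, 1 ≤ w e)
    (t : ℕ) (ht : 1 ≤ t) (h2c : TwoConnected G)
    (hcyc : ∃ (r : V) (C : G.Walk r r), C.IsCycle ∧ t ≤ walkWeight w C) :
    ∀ u v : V, u ≠ v → ∃ P : G.Walk u v, P.IsPath ∧ t ≤ 2 * walkWeight w P := by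
  obtain ⟨hG, -, hdel⟩ := h2c
  obtain ⟨r, C, hC, htC⟩ := hcyc
  obtain ⟨S, hCS, hmax⟩ := (Set.toFinite {S : Set V | HeavilyLinked G w t S}).exists_le_maximal
    (hC.heavilyLinked htC)
  have hnt : S.Nontrivial := by
    refine ⟨r, hCS C.start_mem_support, C.snd, hCS (C.getVert_mem_support 1), ?_⟩
    exact (C.adj_snd hC.not_nil).ne
  have huniv : ∀ x, x ∈ S := by
    by_contra! hx
    obtain ⟨x, hx⟩ := hx
    obtain ⟨s, hs, s', hs', hne, E, hE, hES, y, hyE, hyS⟩ := exists_ear hG hdel hnt hx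
    exact hyS (hmax.2 (hmax.1.union_ear hs hs' hne hE hES) Set.subset_union_left (Or.inr hyE))
  intro u v huv
  obtain ⟨P, hP, hPt, -⟩ := hmax.1 u (huniv u) v (huniv v) huv
  exact ⟨P, hP, hPt⟩
end

section
/- Let t ≥ 2 be an integer and let G be a 2-connected simple graph containing a cycle C of length greater than 2t. If G ≠ C, i.e., G has a vertex not on C or an edge not on C, then G contains θ_{1,2,t}. -/
open SimpleGraph

/-- `G` contains `θ_{a,b,c}`: two distinct vertices joined by three pairwise internally
disjoint paths of lengths at least `a`, `b`, `c`. -/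
def ContainsTheta {V : Type} (G : SimpleGraph V) (a b c : ℕ) : Prop :=
  ∃ (u v : V), u ≠ v ∧ ∃ (P₁ P₂ P₃ : G.Walk u v),
    P₁.IsPath ∧ P₂.IsPath ∧ P₃.IsPath ∧
    a ≤ P₁.length ∧ b ≤ P₂.length ∧ c ≤ P₃.length ∧
    InternallyDisjoint P₁ P₂ ∧ InternallyDisjoint P₁ P₃ ∧ InternallyDisjoint P₂ P₃

namespace SimpleGraph.Walk

variable {V : Type*} {G : SimpleGraph V}

/-- A cycle splits into two internally disjoint paths at any two of its vertices. -/
theorem IsCycle.exists_two_isPath {r u v : V} {C : G.Walk r r} (hC : C.IsCycle)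
    (hu : u ∈ C.support) (hv : v ∈ C.support) (huv : u ≠ v) :
    ∃ P Q : G.Walk u v, P.IsPath ∧ Q.IsPath ∧ P.length + Q.length = C.length ∧
      P.support ⊆ C.support ∧ Q.support ⊆ C.support ∧
      P.edges ⊆ C.edges ∧ Q.edges ⊆ C.edges ∧
      ∀ x, x ∈ P.support → x ∈ Q.support → x = u ∨ x = v := by
  classical
  have hD : (C.rotate u hu).IsCycle := hC.rotate hu
  have hDsupp : ∀ x, x ∈ (C.rotate u hu).support ↔ x ∈ C.support := fun x ↦ by simp
  have hDedges : ∀ e, e ∈ (C.rotate u hu).edges ↔ e ∈ C.edges :=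
    fun e ↦ (C.rotate_edges u hu).mem_iff
  have hDlen : (C.rotate u hu).length = C.length := by simp
  generalize C.rotate u hu = D at *
  have hvD : v ∈ D.support := (hDsupp v).2 hv
  have hspec := D.take_spec hvD
  have hP : (D.takeUntil v hvD).IsPath := hD.isPath_takeUntil hvD
  have hnodup : ((D.takeUntil v hvD).support.tail ++ (D.dropUntil v hvD).support.tail).Nodup := by
    rw [← tail_support_append, hspec]
    exact hD.support_nodup
  have hdisj := List.disjoint_of_nodup_append hnodup
  have hQ : (D.dropUntil v hvD).IsPath := by
    rw [isPath_def, ← cons_tail_support, List.nodup_cons]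
    refine ⟨fun h ↦ hdisj ?_ h, hnodup.of_append_right⟩
    exact end_mem_tail_support (not_nil_of_ne huv)
  refine ⟨D.takeUntil v hvD, (D.dropUntil v hvD).reverse, hP, hQ.reverse, ?_, ?_, ?_, ?_, ?_, ?_⟩
  · rw [length_reverse, ← length_append, hspec, hDlen]
  · exact fun x hx ↦ (hDsupp x).1 (D.support_takeUntil_subset_support hvD hx)
  · exact fun x hx ↦ (hDsupp x).1 (D.support_dropUntil_subset_support hvD (by simpa using hx))
  · exact fun e he ↦ (hDedges e).1 (D.edges_takeUntil_subset_edges hvD he)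
  · exact fun e he ↦ (hDedges e).1 (D.edges_dropUntil_subset_edges hvD (by simpa using he))
  · intro x hxP hxQ
    rw [support_reverse, List.mem_reverse] at hxQ
    rw [mem_support_iff] at hxP hxQ
    rcases hxP with rfl | hxP
    · exact .inl rfl
    rcases hxQ with rfl | hxQ
    · exact .inr rfl
    exact (hdisj hxP hxQ).elim

/-- A walk ending in `S` can be shortened to a path that meets `S` only in its last vertex. -/
theorem exists_isPath_first_mem_s15 (S : Set V) {y z : V} (p : G.Walk y z) (hz : z ∈ S) :
    ∃ v ∈ S, ∃ q : G.Walk y v, q.IsPath ∧ q.support ⊆ p.support ∧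
      ∀ x ∈ q.support, x ∈ S → x = v := by
  classical
  suffices ∃ v ∈ S, ∃ q : G.Walk y v, q.support ⊆ p.support ∧
      ∀ x ∈ q.support, x ∈ S → x = v by
    obtain ⟨v, hv, q, hqp, hq⟩ := this
    exact ⟨v, hv, q.bypass, q.bypass_isPath, fun x hx ↦ hqp (q.support_bypass_subset_support hx),
      fun x hx ↦ hq x (q.support_bypass_subset_support hx)⟩
  induction p with
  | nil => exact ⟨_, hz, nil, by simp, by simp⟩
  | @cons a b c h p ih =>
    by_cases ha : a ∈ S
    · exact ⟨a, ha, nil, by simp, by simp⟩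
    · obtain ⟨v, hv, q, hqp, hq⟩ := ih hz
      refine ⟨v, hv, cons h q, ?_, ?_⟩
      · rw [support_cons, support_cons]
        exact List.cons_subset_cons a hqp
      · intro x hx hxS
        rw [support_cons, List.mem_cons] at hx
        rcases hx with rfl | hx
        · exact (ha hxS).elim
        · exact hq x hx hxS

end SimpleGraph.Walk

/-- In a 2-connected graph, a vertex set with two elements that misses some vertex has an ear
of length at least two. -/
theorem TwoConnected.exists_ear_s15 {V : Type} [Fintype V] {G : SimpleGraph V} (h : TwoConnected G)
    {S : Set V} (hS : S.Nontrivial) {w : V} (hw : w ∉ S) :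
    ∃ u ∈ S, ∃ v ∈ S, u ≠ v ∧ ∃ P : G.Walk u v, P.IsPath ∧ 2 ≤ P.length ∧
      ∀ x ∈ P.support, x ∈ S → x = u ∨ x = v := by
  obtain ⟨s, hs⟩ := hS.nonempty
  obtain ⟨p⟩ := h.1.preconnected s w
  obtain ⟨u, y, huy, hu, hy⟩ : ∃ u y, G.Adj u y ∧ u ∈ S ∧ y ∉ S :=
    have ⟨d, _, hd⟩ := p.exists_boundary_dart S hs hw
    ⟨d.fst, d.snd, d.adj, hd⟩
  obtain ⟨z, hz, hzu⟩ := hS.exists_ne u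
  obtain ⟨q, hq⟩ : ∃ q : G.Walk y z, u ∉ q.support := by
    obtain ⟨q⟩ := (h.2.2 u).preconnected ⟨y, huy.ne'⟩ ⟨z, hzu⟩
    refine ⟨q.map (Embedding.induce _).toHom, fun hx ↦ ?_⟩
    obtain ⟨x, -, hx⟩ := List.mem_map.1 ((congrArg (u ∈ ·) (Walk.support_map _ q)).mp hx)
    exact x.2 hx
  obtain ⟨v, hv, P, hP, hPq, hPS⟩ := q.exists_isPath_first_mem_s15 S hz
  have huP : u ∉ P.support := fun hx ↦ hq (hPq hx)
  have huv : u ≠ v := fun e ↦ huP (e ▸ P.end_mem_support)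
  have hyv : y ≠ v := fun e ↦ hy (e ▸ hv)
  refine ⟨u, hu, v, hv, huv, .cons huy P, hP.cons huP, ?_, ?_⟩
  · have : P.length ≠ 0 := fun h0 ↦ hyv (Walk.eq_of_length_eq_zero h0)
    rw [Walk.length_cons]
    omega
  · intro x hx hxS
    rw [Walk.support_cons, List.mem_cons] at hx
    exact hx.imp_right fun hx ↦ hPS x hx hxS

theorem stmt_15 {V : Type} [Fintype V] (G : SimpleGraph V)
    (t : ℕ) (ht : 2 ≤ t) (h2c : TwoConnected G)
    (r : V) (C : G.Walk r r) (hC : C.IsCycle) (hlen : 2 * t < C.length)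
    (hGneC : (∃ v : V, v ∉ C.support) ∨ (∃ e ∈ G.edgeSet, e ∉ C.edges)) :
    ContainsTheta G 1 2 t := by
  have hear : ∀ u v, u ∈ C.support → v ∈ C.support → u ≠ v → ∀ P : G.Walk u v, P.IsPath →
      (∀ x ∈ P.support, x ∈ C.support → x = u ∨ x = v) →
      (2 ≤ P.length ∨ s(u, v) ∉ C.edges) → ContainsTheta G 1 2 t := by
    intro u v hu hv huv P hP hPC hor
    obtain ⟨A, B, hA, hB, hAB, hAC, hBC, hAe, hBe, hdisj⟩ := hC.exists_two_isPath hu hv huv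
    wlog hle : A.length ≤ B.length generalizing A B
    · exact this B A hB hA (by omega) hBC hAC hBe hAe (fun x h₁ h₂ ↦ hdisj x h₂ h₁) (by omega)
    have hpos : ∀ W : G.Walk u v, 1 ≤ W.length := fun W ↦ by
      by_contra h
      exact huv (Walk.eq_of_length_eq_zero (by omega : W.length = 0))
    rcases hor with hlong | hchord
    · exact ⟨u, v, huv, A, P, B, hA, hP, hB, hpos A, hlong, by omega,
        fun x h₁ h₂ ↦ hPC x h₂ (hAC h₁), hdisj, fun x h₁ h₂ ↦ hPC x h₁ (hBC h₂)⟩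
    · have hA2 : 2 ≤ A.length := by
        by_contra h
        have h1 : A.length = 1 := by have := hpos A; omega
        cases A with
        | nil => exact huv rfl
        | cons h p =>
          cases p with
          | nil => exact hchord (hAe (by simp))
          | cons _ _ => simp at h1
      exact ⟨u, v, huv, P, A, B, hP, hA, hB, hpos P, hA2, by omega,
        fun x h₁ h₂ ↦ hPC x h₁ (hAC h₂), fun x h₁ h₂ ↦ hPC x h₁ (hBC h₂), hdisj⟩
  by_cases hspan : ∃ w, w ∉ C.support
  · obtain ⟨w, hw⟩ := hspan
    have hS : {x | x ∈ C.support}.Nontrivial :=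
      ⟨r, C.start_mem_support, C.snd, C.getVert_mem_support 1, (C.adj_snd hC.not_nil).ne⟩
    obtain ⟨u, hu, v, hv, huv, P, hP, hlong, hPC⟩ := h2c.exists_ear_s15 hS hw
    exact hear u v hu hv huv P hP hPC (.inl hlong)
  · obtain ⟨e, he, heC⟩ := hGneC.resolve_left hspan
    push Not at hspan
    induction e with
    | h u v =>
      have hadj : G.Adj u v := he
      exact hear u v (hspan u) (hspan v) hadj.ne hadj.toWalk (by simp [hadj.ne])
        (by simp) (.inr heC)
end
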